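/- Let (G_i)_{i ∈ ι} be a family of groups and let G = ∗_i G_i be their free product (Mathlib: Monoid.CoprodI). Suppose γ, δ ∈ G are both hyperbolic, i.e. neither is conjugate in G to any element of the image of a factor G_i under the canonical inclusion, suppose neither γ nor δ is a proper power, i.e. for each of them, whenever it equals σ^k for some σ ∈ G and integer k, then k = 1 or k = −1, and suppose γ and δ commute: γ·δ = δ·γ. Then δ = γ or δ = γ⁻¹. -/

import Mathlib

open Monoid

/-- An element of a free product is *hyperbolic* if it is not conjugate to any
element of the image of a factor under the canonical inclusion. -/
def IsHyperbolicElt {ι : Type*} {G : ι → Type*} [∀ i, Group (G i)]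
    (g : CoprodI G) : Prop :=
  ∀ i : ι, ∀ x : G i, ∀ h : CoprodI G, h * CoprodI.of x * h⁻¹ ≠ g

/-- Commuting lists are powers of a common list; here recorded after taking products in a monoid. -/
theorem List.exists_pow_of_append_comm {α M : Type*} [Monoid M] (f : α → M) (v w : List α)
    (h : v ++ w = w ++ v) :
    ∃ (z : M) (m n : ℕ), (v.map f).prod = z ^ m ∧ (w.map f).prod = z ^ n := by
  induction hN : v.length + w.length using Nat.strong_induction_on generalizing v w with
  | _ N ih =>
    subst hN
    rcases eq_or_ne v [] with rfl | hv
    · exact ⟨(w.map f).prod, 0, 1, by simp, by simp⟩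
    rcases eq_or_ne w [] with rfl | hw
    · exact ⟨(v.map f).prod, 1, 0, by simp, by simp⟩
    have hv0 := List.length_pos_iff.2 hv
    have hw0 := List.length_pos_iff.2 hw
    rcases List.append_eq_append_iff.1 h with ⟨t, rfl, ht⟩ | ⟨t, rfl, ht⟩
    · obtain ⟨z, m, n, hm, hn⟩ := ih (v.length + t.length)
        (by simp only [List.length_append]; omega) v t (by simpa using h) rfl
      exact ⟨z, m, m + n, hm, by rw [List.map_append, List.prod_append, hm, hn, pow_add]⟩
    · obtain ⟨z, m, n, hm, hn⟩ := ih (t.length + w.length)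
        (by simp only [List.length_append]; omega) t w (by simpa using h) rfl
      exact ⟨z, n + m, n, by rw [List.map_append, List.prod_append, hm, hn, pow_add], hn⟩

namespace Monoid.CoprodI

open Word

variable {ι : Type*} {G : ι → Type*} [∀ i, Group (G i)]

theorem isConj_prod_cons_append_singleton {i : ι} (x y : G i) (l : List (Σ i, G i)) :
    IsConj (((⟨i, x⟩ :: (l ++ [⟨i, y⟩]) : List (Σ i, G i)).map fun a => of a.2).prod)
      (((l ++ [⟨i, y * x⟩] : List (Σ i, G i)).map fun a => of a.2).prod) :=
  isConj_iff.2 ⟨(of x)⁻¹, by simp [mul_assoc]⟩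

variable [DecidableEq ι] [∀ i, DecidableEq (G i)]

theorem length_of_smul_le {i : ι} (x : G i) (u : Word G) :
    (of x • u).toList.length ≤ u.toList.length + 1 ∧
      ((of x • u).toList.length = u.toList.length + 1 →
        (of x • u).toList = ⟨i, x⟩ :: u.toList) := by
  obtain ⟨p, rfl⟩ := (equivPair i).symm.surjective u
  rw [of_smul_def, Equiv.apply_symm_apply, equivPair_symm]
  by_cases hp : p.head = 1 <;> by_cases hx : x * p.head = 1 <;>
    simp [rcons, hp, hx, cons] <;> grind

theorem fstIdx_of_smul_or_length {i : ι} {x : G i} (hx1 : x ≠ 1) (u : Word G) :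
    (of x • u).fstIdx = some i ∨ (of x • u).toList.length + 1 ≤ u.toList.length := by
  obtain ⟨p, rfl⟩ := (equivPair i).symm.surjective u
  rw [of_smul_def, Equiv.apply_symm_apply, equivPair_symm]
  by_cases hp : p.head = 1 <;> by_cases hx : x * p.head = 1 <;>
    simp [rcons, hp, hx, cons, fstIdx] <;> simp_all

/-- Left multiplication by a reduced word either exposes its first letter or cancels it entirely. -/
theorem fstIdx_prod_smul_or_length (w u : Word G) :
    (w.prod • u).fstIdx = w.fstIdx ∨
      (w.prod • u).toList.length + w.toList.length ≤ u.toList.length := by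
  induction w using consRecOn with
  | empty => simp
  | cons i x w hi hx ih =>
    rw [prod_cons, mul_smul, fstIdx_cons]
    rcases ih with ih | ih
    · left
      have hne : (w.prod • u).fstIdx ≠ some i := ih ▸ hi
      rw [← cons_eq_smul (h1 := hne) (h2 := hx), fstIdx_cons]
    · refine (fstIdx_of_smul_or_length hx (w.prod • u)).imp_right fun h => ?_
      simp only [cons, List.length_cons]
      omega

theorem exists_pow_smul_fstIdx_eq {w : Word G} (hw : w.toList ≠ []) (u : Word G) :
    ∃ k : ℕ, (w.prod ^ k • u).fstIdx = w.fstIdx := by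
  induction hN : u.toList.length using Nat.strong_induction_on generalizing u with
  | _ N ih =>
    rcases fstIdx_prod_smul_or_length w u with h | h
    · exact ⟨1, by simpa using h⟩
    · have := List.length_pos_iff.2 hw
      obtain ⟨k, hk⟩ := ih _ (by omega) (w.prod • u) rfl
      exact ⟨k + 1, by rwa [pow_succ, mul_smul]⟩

/-- A list of letters is at least as long as the reduced word it represents,
and equals it when the lengths agree. -/
theorem length_prod_smul_empty_le (l : List (Σ i, G i)) :
    ((l.map fun a => of a.2).prod • (Word.empty : Word G)).toList.length ≤ l.length ∧
      (((l.map fun a => of a.2).prod • (Word.empty : Word G)).toList.length = l.length →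
        ((l.map fun a => of a.2).prod • (Word.empty : Word G)).toList = l) := by
  induction l with
  | nil => simp [Word.empty]
  | cons a l ih =>
    rw [List.map_cons, List.prod_cons, mul_smul]
    obtain ⟨h1, h2⟩ := length_of_smul_le a.2
      ((l.map fun a => of a.2).prod • (Word.empty : Word G))
    rw [List.length_cons]
    refine ⟨by omega, fun h => ?_⟩
    rw [h2 (by omega), ih.2 (by omega)]

theorem prod_smul_empty (w : Word G) : w.prod • (Word.empty : Word G) = w :=
  (Word.equiv : CoprodI G ≃ Word G).apply_symm_apply w

/-- Every nontrivial hyperbolic element is conjugate to a cyclically reduced word. -/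
theorem exists_isConj_cyclicallyReduced {g : CoprodI G} (hg : IsHyperbolicElt g) (hg1 : g ≠ 1) :
    ∃ w : Word G, IsConj g w.prod ∧ w.toList ≠ [] ∧
      ∀ a ∈ w.toList.getLast?, ∀ b ∈ w.toList.head?, a.1 ≠ b.1 := by
  obtain ⟨w, hw, hmin⟩ := exists_minimalFor_of_wellFoundedLT
    (fun w : Word G => IsConj g w.prod) (fun w => w.toList.length)
    ⟨g • Word.empty, by simp only [prod_smul, prod_empty, mul_one]; exact IsConj.refl g⟩
  beta_reduce at hw hmin
  have hprod : w.prod = (w.toList.map fun a => of a.2).prod := rfl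
  refine ⟨w, hw, fun h => hg1 ?_, ?_⟩
  · rw [hprod, h] at hw
    simpa using hw
  · rcases hl : w.toList with _ | ⟨⟨i, x⟩, l⟩
    · simp
    rcases l.eq_nil_or_concat with rfl | ⟨l, ⟨j, y⟩, rfl⟩
    · rw [hprod, hl] at hw
      obtain ⟨c, hc⟩ := isConj_iff.1 hw.symm
      exact absurd (by simpa using hc) (hg i x c)
    · simp only [List.concat_eq_append] at hl ⊢
      rw [← List.cons_append, List.getLast?_concat]
      simp only [List.cons_append, List.head?_cons, Option.mem_def, Option.some.injEq]
      rintro _ rfl _ rfl (rfl : j = i)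
      rw [hprod, hl] at hw
      have hc := hw.trans (isConj_prod_cons_append_singleton x y l)
      have hle := (length_prod_smul_empty_le (l ++ [⟨j, y * x⟩])).1
      simp only [List.length_append, List.length_cons, List.length_nil] at hle
      have hlen : w.toList.length = l.length + 2 := by simp [hl]
      have := hmin
        (j := ((l ++ [⟨j, y * x⟩] : List (Σ i, G i)).map fun a => of a.2).prod • Word.empty)
        (by simpa only [prod_smul, prod_empty, mul_one] using hc) (by omega)
      omega

/-- An element commuting with a cyclically reduced word is, together with that word, a power of
a common element. -/
theorem exists_zpow_of_commute_cyclicallyReduced {w : Word G} (hw : w.toList ≠ [])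
    (hcyc : ∀ a ∈ w.toList.getLast?, ∀ b ∈ w.toList.head?, a.1 ≠ b.1)
    {g : CoprodI G} (hg : Commute w.prod g) :
    ∃ (z : CoprodI G) (m n : ℤ), w.prod = z ^ m ∧ g = z ^ n := by
  obtain ⟨k, hk⟩ := exists_pow_smul_fstIdx_eq hw (g • Word.empty)
  rw [← mul_smul] at hk
  set v := (w.prod ^ k * g) • (Word.empty : Word G) with hv
  have hvprod : v.prod = w.prod ^ k * g := by simp [hv, prod_smul]
  have hchain : (w.toList ++ v.toList).IsChain (fun a b => a.1 ≠ b.1) := by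
    refine List.isChain_append.2 ⟨w.chain_ne, v.chain_ne, fun a ha b hb => ?_⟩
    obtain ⟨c, hc⟩ : ∃ c, w.toList.head? = some c := ⟨_, List.head?_eq_some_head hw⟩
    have hbc : b.1 = c.1 := by
      simpa [fstIdx, hc, Option.mem_def.1 hb] using hk
    exact hbc ▸ hcyc a ha c hc
  let wv : Word G := ⟨w.toList ++ v.toList, fun a ha =>
    (List.mem_append.1 ha).elim (w.ne_one a) (v.ne_one a), hchain⟩
  have hwv : wv.prod = w.prod * v.prod := by simp [wv, Word.prod]
  have hvw : ((v.toList ++ w.toList).map fun a => of a.2).prod = wv.prod := by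
    have : Commute w.prod v.prod := hvprod ▸ ((Commute.refl _).pow_right k).mul_right hg
    rw [hwv, this.eq]
    simp [Word.prod]
  have happ : v.toList ++ w.toList = w.toList ++ v.toList := by
    have := (length_prod_smul_empty_le (v.toList ++ w.toList)).2
    rw [hvw, prod_smul_empty] at this
    exact (this (by simp [wv, add_comm])).symm
  obtain ⟨z, m, n, hm, hn⟩ := List.exists_pow_of_append_comm (fun a => of a.2) _ _ happ
  have hm : v.prod = z ^ m := hm
  have hn : w.prod = z ^ n := hn
  refine ⟨z, n, -(n * k) + m, by simpa using hn, ?_⟩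
  rw [zpow_add, zpow_neg, zpow_mul, zpow_natCast, zpow_natCast, zpow_natCast, ← hn, ← hm, hvprod,
    inv_mul_cancel_left]

end Monoid.CoprodI

/-- Two commuting hyperbolic elements of a free product that are not proper
powers agree up to inversion (Lemma 4.1, lem:axis-intersection). -/
theorem commuting_hyperbolic_not_proper_powers_eq_or_inv
    {ι : Type*} {G : ι → Type*} [∀ i, Group (G i)]
    (γ δ : CoprodI G) (hγ : IsHyperbolicElt γ) (hδ : IsHyperbolicElt δ)
    (hγroot : ∀ (σ : CoprodI G) (k : ℤ), γ = σ ^ k → k = 1 ∨ k = -1)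
    (hδroot : ∀ (σ : CoprodI G) (k : ℤ), δ = σ ^ k → k = 1 ∨ k = -1)
    (hcomm : γ * δ = δ * γ) :
    δ = γ ∨ δ = γ⁻¹ := by
  classical
  have hγ1 : γ ≠ 1 := fun h => by simpa using hγroot 1 0 (by simpa using h)
  obtain ⟨w, hconj, hw, hcyc⟩ := CoprodI.exists_isConj_cyclicallyReduced hγ hγ1
  obtain ⟨c, hc⟩ := isConj_iff.1 hconj
  have hcomm' : Commute w.prod (c * δ * c⁻¹) := by
    rw [← hc]
    exact (Commute.conj_iff c).2 hcomm
  obtain ⟨z, m, n, hm, hn⟩ := CoprodI.exists_zpow_of_commute_cyclicallyReduced hw hcyc hcomm'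
  have hγz : γ = (c⁻¹ * z * c⁻¹⁻¹) ^ m := by
    rw [conj_zpow, ← hm, ← hc]
    group
  have hδz : δ = (c⁻¹ * z * c⁻¹⁻¹) ^ n := by
    rw [conj_zpow, ← hn]
    group
  rcases hγroot _ _ hγz with rfl | rfl <;> rcases hδroot _ _ hδz with rfl | rfl <;>
    rw [hγz, hδz] <;> simp
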